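/- Let n ≥ 2, let G = BS(1,n) = ⟨a, b ∣ b⁻¹ab = aⁿ⟩ with generating set S = {a, b}, and let N be the kernel of the homomorphism G → ℤ sending a ↦ 0 and b ↦ 1. Then the number of conjugacy classes of G that intersect N ∩ B_S(m) grows exponentially in m: there exists c > 1 such that this number is at least c^m for all sufficiently large m. -/

import Mathlib

/-- The ball of radius `n` in a group `G` with respect to a generating set `S`:
all products of at most `n` elements of `S ∪ S⁻¹`. -/
def wordBall {G : Type*} [Group G] (S : Set G) (n : ℕ) : Set G :=
  {g | ∃ L : List G, L.length ≤ n ∧ (∀ x ∈ L, x ∈ S ∪ S⁻¹) ∧ L.prod = g}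

/-- The defining relation `b⁻¹ aᵐ b (aⁿ)⁻¹` of the Baumslag–Solitar group. -/
def bsRels (m n : ℕ) : Set (FreeGroup (Fin 2)) :=
  {(FreeGroup.of 1)⁻¹ * (FreeGroup.of 0) ^ m * FreeGroup.of 1 * ((FreeGroup.of 0) ^ n)⁻¹}

/-- The Baumslag–Solitar group `BS(m,n) = ⟨a, b ∣ b⁻¹ aᵐ b = aⁿ⟩`. -/
abbrev BS (m n : ℕ) : Type := PresentedGroup (bsRels m n)

/-- The generator `a` of `BS(m,n)`. -/
def bsA (m n : ℕ) : BS m n := PresentedGroup.of 0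

/-- The generator `b` of `BS(m,n)`. -/
def bsB (m n : ℕ) : BS m n := PresentedGroup.of 1

/-- The homomorphism `BS(1,n) → ℤ` sending `a ↦ 0` and `b ↦ 1`
(written multiplicatively, with target `Multiplicative ℤ`). -/
noncomputable def bsLengthHom (n : ℕ) : BS 1 n →* Multiplicative ℤ :=
  PresentedGroup.toGroup
    (f := fun i : Fin 2 => if i = 0 then (1 : Multiplicative ℤ) else Multiplicative.ofAdd 1)
    (by
      intro r hr
      rw [bsRels, Set.mem_singleton_iff] at hr
      subst hr
      simp)

theorem mul_mem_wordBall {G : Type*} [Group G] {S : Set G} {p q : ℕ} {g h : G}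
    (hg : g ∈ wordBall S p) (hh : h ∈ wordBall S q) : g * h ∈ wordBall S (p + q) := by
  obtain ⟨L, hL, hLS, rfl⟩ := hg
  obtain ⟨M, hM, hMS, rfl⟩ := hh
  refine ⟨L ++ M, by simp; omega, fun x hx => ?_, by simp⟩
  rcases List.mem_append.1 hx with hx | hx
  exacts [hLS x hx, hMS x hx]

theorem wordBall_mono {G : Type*} [Group G] (S : Set G) {p q : ℕ} (hpq : p ≤ q) :
    wordBall S p ⊆ wordBall S q := fun _ ⟨L, hL, h⟩ => ⟨L, hL.trans hpq, h⟩

theorem one_mem_wordBall {G : Type*} [Group G] (S : Set G) (p : ℕ) : 1 ∈ wordBall S p :=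
  ⟨[], by simp⟩

theorem mem_wordBall_one {G : Type*} [Group G] {S : Set G} {g : G} (hg : g ∈ S ∪ S⁻¹) :
    g ∈ wordBall S 1 := ⟨[g], by simp, by simpa using hg, by simp⟩

theorem Set.Finite.wordBall {G : Type*} [Group G] {S : Set G} (hS : S.Finite) (m : ℕ) :
    (wordBall S m).Finite := by
  have : Finite ↥(S ∪ S⁻¹) := (hS.union hS.inv).to_subtype
  refine ((List.finite_length_le ↥(S ∪ S⁻¹) m).image
    fun L => (L.map Subtype.val).prod).subset ?_
  rintro g ⟨L, hL, hLS, rfl⟩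
  lift L to List ↥(S ∪ S⁻¹) using hLS
  exact ⟨L, by simpa using hL, rfl⟩

/-- The affine action of `BS(1,n)` on `ℚ`, with `a` acting by `x ↦ x + 1` and `b` by
`x ↦ x / n`. -/
noncomputable def bsAffine (n : ℕ) [NeZero n] : BS 1 n →* Equiv.Perm ℚ :=
  PresentedGroup.toGroup
    (f := fun i : Fin 2 =>
      if i = 0 then Equiv.addRight (1 : ℚ) else (Equiv.mulRight₀ (n : ℚ) (NeZero.ne _))⁻¹)
    (by
      intro r hr
      rw [bsRels, Set.mem_singleton_iff] at hr
      subst hr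
      have hn : (n : ℚ) ≠ 0 := NeZero.ne _
      simp only [map_mul, map_inv, map_pow, FreeGroup.lift_apply_of, mul_inv_eq_one]
      ext x
      simp [add_mul, hn])

section Affine

variable {n : ℕ} [NeZero n]

theorem bsAffine_bsA (x : ℚ) : bsAffine n (bsA 1 n) x = x + 1 := by
  simp [bsAffine, bsA]

theorem bsAffine_bsB_inv (x : ℚ) : (bsAffine n (bsB 1 n))⁻¹ x = x * n := by
  simp [bsAffine, bsB]

theorem bsAffine_bsB (x : ℚ) : bsAffine n (bsB 1 n) x = x / n := by
  rw [← Equiv.Perm.eq_inv_iff_eq, bsAffine_bsB_inv, div_mul_cancel₀ _ (NeZero.ne _)]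

theorem exists_bsAffine_eq (g : BS 1 n) :
    ∃ (j : ℤ) (d : ℚ), ∀ x, bsAffine n g x = (n : ℚ) ^ j * x + d := by
  have hn : (n : ℚ) ≠ 0 := NeZero.ne _
  have hg : g ∈ Subgroup.closure (Set.range (PresentedGroup.of (rels := bsRels 1 n))) := by
    rw [PresentedGroup.closure_range_of]; trivial
  induction hg using Subgroup.closure_induction with
  | mem g hg =>
    obtain ⟨i, rfl⟩ := hg
    fin_cases i
    · exact ⟨0, 1, fun x => by rw [zpow_zero, one_mul]; exact bsAffine_bsA x⟩
    · exact ⟨-1, 0, fun x => by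
        rw [zpow_neg_one, add_zero, ← div_eq_inv_mul]; exact bsAffine_bsB x⟩
  | one => exact ⟨0, 0, by simp⟩
  | mul g h _ _ hg hh =>
    obtain ⟨j, d, hg⟩ := hg
    obtain ⟨k, e, hh⟩ := hh
    refine ⟨j + k, (n : ℚ) ^ j * e + d, fun x => ?_⟩
    rw [map_mul, Equiv.Perm.mul_apply, hg, hh, zpow_add₀ hn]
    ring
  | inv g _ hg =>
    obtain ⟨j, d, hg⟩ := hg
    refine ⟨-j, -((n : ℚ) ^ (-j) * d), fun x => ?_⟩
    rw [map_inv, Equiv.Perm.inv_eq_iff_eq, hg, zpow_neg]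
    field_simp
    ring

/-- Conjugate translations differ by a power of `n`. -/
theorem IsConj.exists_zpow_mul_eq {g h : BS 1 n} (hgh : IsConj g h) {u v : ℚ}
    (hg : ∀ x, bsAffine n g x = x + u) (hh : ∀ x, bsAffine n h x = x + v) :
    ∃ j : ℤ, (n : ℚ) ^ j * u = v := by
  obtain ⟨c, hc⟩ := isConj_iff.1 hgh
  obtain ⟨j, d, hd⟩ := exists_bsAffine_eq c
  have key := congrArg (fun t => bsAffine n t 0) (mul_inv_eq_iff_eq_mul.1 hc)
  simp only [map_mul, Equiv.Perm.mul_apply, hg, hh, hd] at key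
  exact ⟨j, by linarith⟩

end Affine

theorem Nat.eq_of_zpow_mul_eq {n x y : ℕ} (hn : n ≠ 0) (hx : ¬ n ∣ x) (hy : ¬ n ∣ y) {j : ℤ}
    (h : (n : ℚ) ^ j * x = y) : x = y := by
  have hn' : (n : ℚ) ≠ 0 := by exact_mod_cast hn
  obtain ⟨k, rfl | rfl⟩ := j.eq_nat_or_neg
  · rw [zpow_natCast] at h
    norm_cast at h
    cases k with
    | zero => simpa using h
    | succ k => exact absurd ⟨n ^ k * x, by rw [← h]; ring⟩ hy
  · rw [zpow_neg, zpow_natCast, inv_mul_eq_iff_eq_mul₀ (pow_ne_zero _ hn')] at h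
    norm_cast at h
    cases k with
    | zero => simpa using h
    | succ k => exact absurd ⟨n ^ k * y, by rw [h]; ring⟩ hx

/-- The power of `a` whose exponent has the base-`n` digits in the list, least significant first,
written by Horner's rule. -/
def bsHorner (n : ℕ) : List Bool → BS 1 n
  | [] => 1
  | ε :: l => bsA 1 n ^ ε.toNat * ((bsB 1 n)⁻¹ * bsHorner n l * bsB 1 n)

theorem bsHorner_mem_ker (n : ℕ) (l : List Bool) : bsHorner n l ∈ (bsLengthHom n).ker := by
  induction l with
  | nil => exact one_mem _
  | cons ε l ih =>
    have ha : bsA 1 n ∈ (bsLengthHom n).ker := by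
      simp [MonoidHom.mem_ker, bsLengthHom, bsA]
    exact mul_mem (pow_mem ha _)
      (by simpa using (bsLengthHom n).normal_ker.conj_mem _ ih (bsB 1 n)⁻¹)

theorem bsHorner_mem_wordBall (n : ℕ) (l : List Bool) :
    bsHorner n l ∈ wordBall ({bsA 1 n, bsB 1 n} : Set (BS 1 n)) (3 * l.length) := by
  induction l with
  | nil => exact one_mem_wordBall _ _
  | cons ε l ih =>
    have ha : bsA 1 n ^ ε.toNat ∈ wordBall ({bsA 1 n, bsB 1 n} : Set (BS 1 n)) 1 := by
      cases ε
      · simpa using one_mem_wordBall _ _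
      · exact mem_wordBall_one (by simp)
    refine wordBall_mono _ (le_of_eq ?_) (mul_mem_wordBall ha (mul_mem_wordBall (mul_mem_wordBall
      (mem_wordBall_one (g := (bsB 1 n)⁻¹) (by simp)) ih) (mem_wordBall_one (by simp))))
    simp only [List.length_cons]
    ring

theorem bsAffine_bsHorner {n : ℕ} [NeZero n] (l : List Bool) (x : ℚ) :
    bsAffine n (bsHorner n l) x = x + (Nat.ofDigits n (l.map Bool.toNat) : ℕ) := by
  have hn : (n : ℚ) ≠ 0 := NeZero.ne _
  induction l generalizing x with
  | nil => simp [bsHorner]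
  | cons ε l ih =>
    have hconj : bsAffine n ((bsB 1 n)⁻¹ * bsHorner n l * bsB 1 n) x =
        x + n * (Nat.ofDigits n (l.map Bool.toNat) : ℕ) := by
      rw [map_mul, map_mul, map_inv, Equiv.Perm.mul_apply, Equiv.Perm.mul_apply,
        bsAffine_bsB_inv, ih, bsAffine_bsB]
      field_simp
    rw [bsHorner, map_mul, Equiv.Perm.mul_apply, hconj]
    cases ε
    · simp [Nat.ofDigits_cons]
    · simp only [Bool.toNat_true, pow_one, bsAffine_bsA, List.map_cons, Nat.ofDigits_cons]
      push_cast
      ring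

theorem two_pow_le_card_conjClasses {n : ℕ} (hn : 2 ≤ n) {k m : ℕ} (hkm : 3 * (k + 1) ≤ m) :
    2 ^ k ≤ Nat.card {x : ConjClasses (BS 1 n) // ∃ g ∈ (bsLengthHom n).ker,
      g ∈ wordBall ({bsA 1 n, bsB 1 n} : Set (BS 1 n)) m ∧ ConjClasses.mk g = x} := by
  have : NeZero n := ⟨by omega⟩
  have hfin : Finite {x : ConjClasses (BS 1 n) // ∃ g ∈ (bsLengthHom n).ker,
      g ∈ wordBall ({bsA 1 n, bsB 1 n} : Set (BS 1 n)) m ∧ ConjClasses.mk g = x} := by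
    refine (((Set.toFinite {bsA 1 n, bsB 1 n}).wordBall m).image ConjClasses.mk).subset ?_
    rintro _ ⟨g, -, hg, rfl⟩
    exact ⟨g, hg, rfl⟩
  have hcard : Nat.card (List.Vector Bool k) = 2 ^ k := by simp
  rw [← hcard]
  refine Nat.card_le_card_of_injective (fun l => ⟨ConjClasses.mk (bsHorner n (true :: l.toList)),
    _, bsHorner_mem_ker n _, wordBall_mono _ (by simpa using hkm) (bsHorner_mem_wordBall n _),
    rfl⟩) fun l l' h => ?_
  have hdvd (l : List Bool) : ¬ n ∣ Nat.ofDigits n ((true :: l).map Bool.toNat) := by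
    rw [List.map_cons, Nat.ofDigits_cons, Nat.dvd_add_left (dvd_mul_right _ _)]
    simp; omega
  have hlt (l : List Bool) : ∀ d ∈ (true :: l).map Bool.toNat, d < n := by
    simp only [List.mem_map, forall_exists_index, and_imp]
    rintro _ ε - rfl
    exact (Bool.toNat_lt ε).trans_le hn
  obtain ⟨j, hj⟩ := (ConjClasses.mk_eq_mk_iff_isConj.1 (Subtype.ext_iff.1 h)).exists_zpow_mul_eq
    (bsAffine_bsHorner _) (bsAffine_bsHorner _)
  have heq := Nat.ofDigits_inj_of_len_eq hn (by simp) (hlt _) (hlt _)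
    (Nat.eq_of_zpow_mul_eq (NeZero.ne n) (hdvd _) (hdvd _) hj)
  have hinj : Function.Injective Bool.toNat := by decide
  exact List.Vector.toList_injective (List.cons.inj (List.map_injective_iff.2 hinj heq)).2

/-- For `n ≥ 2`, the number of conjugacy classes of `BS(1,n)` meeting
`N ∩ B_S(m)`, where `N` is the kernel of the homomorphism `BS(1,n) → ℤ` with
`a ↦ 0`, `b ↦ 1`, grows exponentially in `m`. -/
theorem bs_kernel_conj_growth_exponential (n : ℕ) (hn : 2 ≤ n) :
    ∃ c : ℝ, 1 < c ∧ ∃ N : ℕ, ∀ m ≥ N,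
      c ^ m ≤ (Nat.card {x : ConjClasses (BS 1 n) //
        ∃ g ∈ (bsLengthHom n).ker,
          g ∈ wordBall ({bsA 1 n, bsB 1 n} : Set (BS 1 n)) m ∧ ConjClasses.mk g = x} : ℝ) := by
  refine ⟨21 / 20, by norm_num, 6, fun m hm => ?_⟩
  obtain ⟨k, hk⟩ : ∃ k, m / 3 = k + 1 := ⟨m / 3 - 1, by omega⟩
  have hcard := two_pow_le_card_conjClasses hn (k := k) (m := m) (by omega)
  calc (21 / 20 : ℝ) ^ m ≤ (21 / 20) ^ (8 * k) := pow_le_pow_right₀ (by norm_num) (by omega)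
    _ = ((21 / 20) ^ 8) ^ k := pow_mul _ _ _
    _ ≤ 2 ^ k := pow_le_pow_left₀ (by norm_num) (by norm_num) _
    _ ≤ _ := by exact_mod_cast hcard
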